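/- Let 0 < r₁ < r₂ and let r₃ := √(r₂² − r₁²), so that the disk B_{r₃} has the same area as the annulus A_{r₁,r₂} and r₃ < r₂. Then there exists α₁ < 0 such that for all α < α₁ one has λ₁^α(B_{r₃}) < μ₁^α(A_{r₁,r₂}); that is, the inequality μ₁^α(A_{r₁,r₂}) ≤ λ₁^α(B_{r₃}) fails for all sufficiently large negative α. -/

import Mathlib

open MeasureTheory Metric Filter Asymptotics Real RealInnerProductSpace

noncomputable section

abbrev Eu (d : ℕ) := EuclideanSpace ℝ (Fin d)

/-- The set of Rayleigh quotient values of nonzero Lipschitz test functions for the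
Robin problem with boundary parameter `α` on `Ω ⊆ ℝ^d`. -/
def robinRayleighSet (d : ℕ) (α : ℝ) (Ω : Set (Eu d)) : Set ℝ :=
  { lam : ℝ | ∃ (u : Eu d → ℝ) (K : NNReal),
      LipschitzOnWith K u (closure Ω) ∧
      (∫ x in Ω, (u x) ^ 2) ≠ 0 ∧
      lam = ((∫ x in Ω, ‖fderiv ℝ u x‖ ^ 2)
              + α * ∫ x in frontier Ω, (u x) ^ 2 ∂(μH[(d : ℝ) - 1]))
            / (∫ x in Ω, (u x) ^ 2) }

/-- The first Robin eigenvalue `λ₁^α(Ω)`, defined variationally. -/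
def robinEig (d : ℕ) (α : ℝ) (Ω : Set (Eu d)) : ℝ :=
  sInf (robinRayleighSet d α Ω)

/-- The first eigenvalue `μ₁^α(A_{r₁,r₂})` of the Laplacian on the planar annulus
`A_{r₁,r₂}` with Robin boundary condition (parameter `α`) on the outer circle and
Neumann condition on the inner circle, defined variationally. -/
def nrEig (α r₁ r₂ : ℝ) : ℝ :=
  sInf { lam : ℝ | ∃ ψ : ℝ → ℝ, ContDiff ℝ (⊤ : ℕ∞) ψ ∧
    (∫ r in r₁..r₂, (ψ r) ^ 2 * r) ≠ 0 ∧
    lam = ((∫ r in r₁..r₂, (deriv ψ r) ^ 2 * r) + α * r₂ * (ψ r₂) ^ 2)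
          / (∫ r in r₁..r₂, (ψ r) ^ 2 * r) }


/-- Weighted boundary estimate obtained by integrating the derivative of `r φ(r) ψ(r)²`. -/
lemma boundary_term_le_of_multiplier {r₁ r₂ L : ℝ} (hr₁ : 0 < r₁) (hr₁₂ : r₁ < r₂)
    {ψ φ φ' : ℝ → ℝ} (hψ : ContDiff ℝ (⊤ : ℕ∞) ψ)
    (hφ : ∀ r, HasDerivAt φ (φ' r) r) (hφ' : Continuous φ') (h0 : φ r₁ = 0)
    (hL : ∀ r ∈ Set.Icc r₁ r₂, r * φ r ^ 2 + φ r + r * φ' r ≤ L * r) :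
    r₂ * φ r₂ * ψ r₂ ^ 2 ≤
      (∫ r in r₁..r₂, (deriv ψ r) ^ 2 * r) + L * ∫ r in r₁..r₂, (ψ r) ^ 2 * r := by
  have hφc : Continuous φ := continuous_iff_continuousAt.2 fun r => (hφ r).continuousAt
  have hψc : Continuous ψ := hψ.continuous
  have hdψ : Continuous (deriv ψ) := hψ.continuous_deriv (by simp)
  have hder : ∀ r, HasDerivAt ψ (deriv ψ r) r := fun r =>
    (hψ.differentiable (by simp) r).hasDerivAt
  have hF : ∀ r, HasDerivAt (fun r => r * φ r * ψ r ^ 2)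
      ((φ r + r * φ' r) * ψ r ^ 2 + r * φ r * (2 * ψ r * deriv ψ r)) r := by
    intro r
    have := ((hasDerivAt_id r).mul (hφ r)).mul ((hder r).pow 2)
    refine this.congr_deriv ?_
    simp
  have hint := intervalIntegral.integral_eq_sub_of_hasDerivAt (a := r₁) (b := r₂)
    (fun r _ => hF r) (Continuous.intervalIntegrable (by fun_prop) _ _)
  rw [h0] at hint
  have hle : (∫ r in r₁..r₂, ((φ r + r * φ' r) * ψ r ^ 2 + r * φ r * (2 * ψ r * deriv ψ r))) ≤
      ∫ r in r₁..r₂, ((deriv ψ r) ^ 2 * r + L * ((ψ r) ^ 2 * r)) := by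
    refine intervalIntegral.integral_mono_on hr₁₂.le
      (Continuous.intervalIntegrable (by fun_prop) _ _)
      (Continuous.intervalIntegrable (by fun_prop) _ _) fun r hr => ?_
    have hr0 : 0 < r := hr₁.trans_le hr.1
    have h1 := mul_le_mul_of_nonneg_right (hL r hr) (sq_nonneg (ψ r))
    have h2 := mul_nonneg hr0.le (sq_nonneg (φ r * ψ r - deriv ψ r))
    nlinarith
  rw [hint, intervalIntegral.integral_add (Continuous.intervalIntegrable (by fun_prop) _ _)
    (Continuous.intervalIntegrable (by fun_prop) _ _),
    intervalIntegral.integral_const_mul] at hle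
  linarith

/-- For large `a`, the Neumann–Robin eigenvalue with parameter `-a` is bounded below by
`-a² - a (1 / r₂ + ε)`. -/
lemma le_nrEig {r₁ r₂ a ε : ℝ} (hr₁ : 0 < r₁) (hr₁₂ : r₁ < r₂) (ha : 0 < a)
    (haε : ((r₂ - r₁) / (r₁ * r₂) + 2 / (r₂ - r₁)) ^ 2 ≤ 4 * a * ε) :
    -a ^ 2 - a * (1 / r₂ + ε) ≤ nrEig (-a) r₁ r₂ := by
  have hd : 0 < r₂ - r₁ := sub_pos.2 hr₁₂
  have hr₂ : 0 < r₂ := hr₁.trans hr₁₂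
  refine le_csInf ⟨_, fun _ => 1, contDiff_const, ?_, rfl⟩ ?_
  · simp only [one_pow, one_mul, integral_id]
    nlinarith
  rintro _ ⟨ψ, hψ, hne, rfl⟩
  have hpos : 0 < ∫ r in r₁..r₂, (ψ r) ^ 2 * r := by
    refine lt_of_le_of_ne (intervalIntegral.integral_nonneg hr₁₂.le fun r hr => ?_) hne.symm
    exact mul_nonneg (sq_nonneg _) (hr₁.le.trans hr.1)
  have key := boundary_term_le_of_multiplier (L := a ^ 2 + a * (1 / r₂ + ε)) hr₁ hr₁₂ hψ
    (φ := fun r => a * (1 - ((r₂ - r) / (r₂ - r₁)) ^ 2))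
    (φ' := fun r => a * (2 / (r₂ - r₁) * ((r₂ - r) / (r₂ - r₁)))) ?_ (by fun_prop) ?_ ?_
  · rw [le_div_iff₀ hpos]
    simp only [sub_self, zero_div] at key
    linarith
  · intro r
    have := (((((hasDerivAt_id r).const_sub r₂).div_const (r₂ - r₁)).pow 2).const_sub 1).const_mul a
    refine this.congr_deriv ?_
    simp
    ring
  · simp [div_self hd.ne']
  · intro r hr
    have hr0 : 0 < r := hr₁.trans_le hr.1
    set w := (r₂ - r) / (r₂ - r₁) with hw
    have hw0 : 0 ≤ w := div_nonneg (sub_nonneg.2 hr.2) hd.le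
    have hw1 : w ≤ 1 := by rw [hw, div_le_one hd]; linarith [hr.1]
    have hinv : 1 / r ≤ 1 / r₂ + (r₂ - r₁) / (r₁ * r₂) * w := by
      have : 1 / r - 1 / r₂ = (r₂ - r) / (r * r₂) := by field_simp
      have h2 : (r₂ - r₁) / (r₁ * r₂) * w = (r₂ - r) / (r₁ * r₂) := by
        rw [hw]; field_simp
      have h3 : (r₂ - r) / (r * r₂) ≤ (r₂ - r) / (r₁ * r₂) := by
        refine div_le_div_of_nonneg_left (sub_nonneg.2 hr.2) (by positivity) ?_
        exact mul_le_mul_of_nonneg_right hr.1 hr₂.le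
      linarith
    set M := (r₂ - r₁) / (r₁ * r₂) + 2 / (r₂ - r₁) with hM
    have hquad : M * w ≤ a * w ^ 2 + ε := by
      have h1 : 0 ≤ (2 * a * w - M) ^ 2 := sq_nonneg _
      have h2 : 0 ≤ 4 * a * (a * w ^ 2 + ε - M * w) := by nlinarith
      have := nonneg_of_mul_nonneg_right h2 (by positivity)
      linarith
    have hw2 : (1 - w ^ 2) * (1 / r) ≤ 1 / r :=
      mul_le_of_le_one_left (by positivity) (by nlinarith [sq_nonneg w])
    have hw3 : (1 - w ^ 2) ^ 2 ≤ 1 - w ^ 2 := by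
      have : 0 ≤ w ^ 2 * (1 - w ^ 2) := mul_nonneg (sq_nonneg w) (by nlinarith)
      linarith
    have hmain : (a * (1 - w ^ 2)) ^ 2 + a * ((1 - w ^ 2) * (1 / r)) + a * (2 / (r₂ - r₁) * w) ≤
        a ^ 2 + a * (1 / r₂ + ε) := by
      have h1 : (1 - w ^ 2) * (1 / r) + 2 / (r₂ - r₁) * w ≤ a * w ^ 2 + (1 / r₂ + ε) := by
        have : M * w = (r₂ - r₁) / (r₁ * r₂) * w + 2 / (r₂ - r₁) * w := by rw [hM]; ring
        linarith
      have h2 := mul_le_mul_of_nonneg_left h1 ha.le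
      have h3 := mul_le_mul_of_nonneg_left hw3 (sq_nonneg a)
      nlinarith
    have h4 := mul_le_mul_of_nonneg_right hmain hr0.le
    calc _ = ((a * (1 - w ^ 2)) ^ 2 + a * ((1 - w ^ 2) * (1 / r)) + a * (2 / (r₂ - r₁) * w)) * r := by
          field_simp
      _ ≤ _ := h4

lemma setIntegral_ball_fun_norm (g : ℝ → ℝ) {ρ : ℝ} (hρ : 0 < ρ) :
    (∫ x in ball (0 : Eu 2) ρ, g ‖x‖) = 2 * π * ∫ r in (0 : ℝ)..ρ, r * g r := by
  have h1 : (∫ x in ball (0 : Eu 2) ρ, g ‖x‖) =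
      ∫ x : Eu 2, (Set.Iio ρ).indicator g ‖x‖ := by
    rw [← integral_indicator measurableSet_ball]
    congr 1
    ext x
    by_cases hx : ‖x‖ < ρ
    · rw [Set.indicator_of_mem (by simpa using hx), Set.indicator_of_mem (by simpa using hx)]
    · rw [Set.indicator_of_notMem (by simpa using hx), Set.indicator_of_notMem (by simpa using hx)]
  rw [h1, integral_fun_norm_addHaar volume ((Set.Iio ρ).indicator g)]
  have h2 : (∫ y in Set.Ioi (0 : ℝ), y ^ (Module.finrank ℝ (Eu 2) - 1) •
      (Set.Iio ρ).indicator g y) = ∫ r in (0 : ℝ)..ρ, r * g r := by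
    have h3 : ∀ y : ℝ, y ^ (Module.finrank ℝ (Eu 2) - 1) • (Set.Iio ρ).indicator g y =
        (Set.Iio ρ).indicator (fun r => r * g r) y := by
      intro y
      by_cases hy : y < ρ
      · simp [Set.indicator_of_mem (Set.mem_Iio.2 hy)]
      · simp [Set.indicator_of_notMem (mt Set.mem_Iio.1 hy)]
    simp only [h3]
    rw [intervalIntegral.integral_of_le hρ.le, integral_Ioc_eq_integral_Ioo,
      setIntegral_indicator measurableSet_Iio, Set.Ioi_inter_Iio]
  have h3 : volume.real (ball (0 : Eu 2) 1) = π := by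
    simp [Measure.real, EuclideanSpace.volume_ball_fin_two, pi_pos.le]
  rw [h2, h3]
  simp
  ring

lemma integral_mul_exp (a ρ : ℝ) (ha : a ≠ 0) :
    (∫ r in (0 : ℝ)..ρ, r * Real.exp (a * r) ^ 2) =
      (Real.exp (2 * a * ρ) * (2 * a * ρ - 1) + 1) / (4 * a ^ 2) := by
  have hF : ∀ r : ℝ, HasDerivAt (fun r => Real.exp (2 * a * r) * (2 * a * r - 1) / (4 * a ^ 2))
      (r * Real.exp (a * r) ^ 2) r := by
    intro r
    have h1 := (hasDerivAt_id r).const_mul (2 * a)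
    have := (h1.exp.mul (h1.sub_const 1)).div_const (4 * a ^ 2)
    refine this.congr_deriv ?_
    have : Real.exp (a * r) ^ 2 = Real.exp (2 * a * r) := by
      rw [← Real.exp_nat_mul]; congr 1; push_cast; ring
    rw [this]
    simp only [id]
    field_simp
    ring
  rw [intervalIntegral.integral_eq_sub_of_hasDerivAt (fun r _ => hF r)
    (Continuous.intervalIntegrable (by fun_prop) _ _)]
  simp
  ring

lemma norm_fderiv_exp_norm {a : ℝ} {x : Eu 2} (hx : x ≠ 0) :
    ‖fderiv ℝ (fun x : Eu 2 => Real.exp (a * ‖x‖)) x‖ ^ 2 = a ^ 2 * Real.exp (a * ‖x‖) ^ 2 := by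
  have hd : DifferentiableAt ℝ (fun x : Eu 2 => ‖x‖) x := differentiableAt_id.norm ℝ hx
  have := (hd.hasFDerivAt.const_mul a).exp.fderiv
  rw [this, norm_smul, norm_smul, norm_fderiv_norm hd]
  simp only [Real.norm_eq_abs, mul_one, mul_pow, sq_abs]
  ring

/-- The test function `exp (a ‖x‖)` bounds the first Robin eigenvalue of a disk from above. -/
lemma robinEig_ball_le {a ρ : ℝ} (ha : 0 < a) (hρ : 0 < ρ)
    (hfin : IsFiniteMeasure ((μH[1] : Measure (Eu 2)).restrict (sphere 0 ρ)))
    (hH : ENNReal.ofReal (2 * π * ρ) ≤ (μH[1] : Measure (Eu 2)) (sphere 0 ρ))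
    (hbdd : BddBelow (robinRayleighSet 2 (-a) (ball 0 ρ))) :
    robinEig 2 (-a) (ball (0 : Eu 2) ρ) ≤ -a ^ 2 - a / ρ := by
  set E := Real.exp (2 * a * ρ) with hE
  have hD : (∫ x in ball (0 : Eu 2) ρ, Real.exp (a * ‖x‖) ^ 2) =
      2 * π * ((E * (2 * a * ρ - 1) + 1) / (4 * a ^ 2)) := by
    rw [setIntegral_ball_fun_norm (fun r => Real.exp (a * r) ^ 2) hρ, integral_mul_exp a ρ ha.ne']
  have hEt : 2 * a * ρ + 1 < E := Real.add_one_lt_exp (by positivity)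
  have hnum : 0 < E * (2 * a * ρ - 1) + 1 := by
    have h1 := Real.add_one_lt_exp (x := -(2 * a * ρ)) (neg_ne_zero.2 (by positivity))
    have h2 : E * Real.exp (-(2 * a * ρ)) = 1 := by rw [hE, ← Real.exp_add]; simp
    have := mul_lt_mul_of_pos_left h1 (Real.exp_pos (2 * a * ρ))
    rw [← hE, h2] at this
    linarith
  have hDpos : 0 < ∫ x in ball (0 : Eu 2) ρ, Real.exp (a * ‖x‖) ^ 2 := by
    rw [hD]; positivity
  have hN : (∫ x in ball (0 : Eu 2) ρ, ‖fderiv ℝ (fun x : Eu 2 => Real.exp (a * ‖x‖)) x‖ ^ 2) =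
      a ^ 2 * ∫ x in ball (0 : Eu 2) ρ, Real.exp (a * ‖x‖) ^ 2 := by
    rw [← integral_const_mul]
    refine integral_congr_ae (ae_restrict_of_ae ?_)
    have : ∀ᵐ x : Eu 2, x ≠ 0 := by
      simp [ae_iff]
    filter_upwards [this] with x hx using norm_fderiv_exp_norm hx
  have hT : (∫ x in frontier (ball (0 : Eu 2) ρ), Real.exp (a * ‖x‖) ^ 2
      ∂(μH[((2 : ℕ) : ℝ) - 1] : Measure (Eu 2))) =
      (μH[1] : Measure (Eu 2)).real (sphere 0 ρ) * E := by
    have h1 : ((2 : ℕ) : ℝ) - 1 = 1 := by norm_num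
    rw [h1, frontier_ball _ hρ.ne', setIntegral_congr_fun (g := fun _ => E)
      isClosed_sphere.measurableSet, setIntegral_const, smul_eq_mul]
    intro x hx
    have : ‖x‖ = ρ := by simpa using hx
    simp only [this]
    rw [hE, ← Real.exp_nat_mul]; congr 1; push_cast; ring
  have hS : 2 * π * ρ ≤ (μH[1] : Measure (Eu 2)).real (sphere 0 ρ) := by
    refine (ENNReal.ofReal_le_iff_le_toReal ?_).1 hH
    have := measure_ne_top ((μH[1] : Measure (Eu 2)).restrict (sphere 0 ρ)) Set.univ
    simpa using this
  have hmem : (a ^ 2 * (∫ x in ball (0 : Eu 2) ρ, Real.exp (a * ‖x‖) ^ 2) +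
      -a * ((μH[1] : Measure (Eu 2)).real (sphere 0 ρ) * E)) /
      (∫ x in ball (0 : Eu 2) ρ, Real.exp (a * ‖x‖) ^ 2) ∈
      robinRayleighSet 2 (-a) (ball 0 ρ) := by
    obtain ⟨K, hK⟩ := (LocallyLipschitzOn.exists_lipschitzOnWith_of_compact (s := Set.Icc 0 ρ)
      (f := fun r : ℝ => Real.exp (a * r))
      isCompact_Icc (ContDiff.locallyLipschitz (𝕂 := ℝ) (by fun_prop)).locallyLipschitzOn)
    refine ⟨fun x => Real.exp (a * ‖x‖), K * 1, ?_, hDpos.ne', ?_⟩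
    · refine hK.comp (lipschitzWith_one_norm.lipschitzOnWith) fun x hx => ?_
      rw [closure_ball _ hρ.ne'] at hx
      exact ⟨norm_nonneg _, by simpa using hx⟩
    · rw [hN, hT]
  refine (csInf_le hbdd hmem).trans ?_
  rw [div_le_iff₀ hDpos, hD]
  have h1 : 2 * π * ρ * E ≤ (μH[1] : Measure (Eu 2)).real (sphere 0 ρ) * E :=
    mul_le_mul_of_nonneg_right hS (Real.exp_pos _).le
  have h2 := mul_le_mul_of_nonneg_left h1 ha.le
  have h3 : (2 * a ^ 2 + a / ρ) * (2 * π * ((E * (2 * a * ρ - 1) + 1) / (4 * a ^ 2))) =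
      π / (2 * a * ρ) * ((2 * a * ρ + 1) * (E * (2 * a * ρ - 1) + 1)) := by
    field_simp
    norm_num
  have h4 : (2 * a * ρ + 1) * (E * (2 * a * ρ - 1) + 1) ≤ (2 * a * ρ) ^ 2 * E := by
    nlinarith
  have h5 := mul_le_mul_of_nonneg_left h4 (by positivity : 0 ≤ π / (2 * a * ρ))
  have h6 : π / (2 * a * ρ) * ((2 * a * ρ) ^ 2 * E) = a * (2 * π * ρ * E) := by
    field_simp
  linarith

/-- The circle of radius `ρ` centered at the origin, parametrized in the Euclidean plane. -/
def circleParam (ρ θ : ℝ) : Eu 2 := Complex.orthonormalBasisOneI.repr (circleMap 0 ρ θ)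

lemma lipschitzWith_circleParam {ρ : ℝ} : LipschitzWith (Real.nnabs ρ) (circleParam ρ) := by
  have h := Complex.orthonormalBasisOneI.repr.isometry.lipschitz.comp (lipschitzWith_circleMap 0 ρ)
  rw [one_mul] at h
  exact h

lemma sphere_subset_circleParam_image {ρ : ℝ} :
    sphere (0 : Eu 2) ρ ⊆ circleParam ρ '' Set.Ioc (-π) π := by
  intro x hx
  set z := Complex.orthonormalBasisOneI.repr.symm x with hz
  have hzn : ‖z‖ = ρ := by
    rw [hz, LinearIsometryEquiv.norm_map]
    simpa using hx
  refine ⟨z.arg, Complex.arg_mem_Ioc z, ?_⟩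
  have : circleMap 0 ρ z.arg = z := by
    rw [circleMap_zero, ← hzn, Complex.norm_mul_exp_arg_mul_I]
  rw [circleParam, this, hz, LinearIsometryEquiv.apply_symm_apply]

lemma hausdorffMeasure_restrict_sphere_le {ρ : ℝ} (hρ : 0 < ρ) :
    (μH[1] : Measure (Eu 2)).restrict (sphere 0 ρ) ≤
      ENNReal.ofReal ρ • (volume.restrict (Set.Ioc (-π) π)).map (circleParam ρ) := by
  refine Measure.le_iff.2 fun A hA => ?_
  have hm : Measurable (circleParam ρ) := lipschitzWith_circleParam.continuous.measurable
  rw [Measure.restrict_apply hA, Measure.smul_apply, Measure.map_apply hm hA,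
    Measure.restrict_apply (hm hA)]
  have hsub : A ∩ sphere 0 ρ ⊆ circleParam ρ '' (circleParam ρ ⁻¹' A ∩ Set.Ioc (-π) π) := by
    rintro x ⟨hxA, hx⟩
    obtain ⟨θ, hθ, rfl⟩ := sphere_subset_circleParam_image hx
    exact ⟨θ, ⟨hxA, hθ⟩, rfl⟩
  refine (measure_mono hsub).trans ?_
  have := (lipschitzWith_circleParam (ρ := ρ)).hausdorffMeasure_image_le zero_le_one
    (circleParam ρ ⁻¹' A ∩ Set.Ioc (-π) π)
  rw [hausdorffMeasure_real] at this
  refine this.trans (le_of_eq ?_)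
  rw [ENNReal.rpow_one, smul_eq_mul, Real.nnabs_of_nonneg hρ.le]
  rfl

lemma isFiniteMeasure_hausdorffMeasure_restrict_sphere {ρ : ℝ} (hρ : 0 < ρ) :
    IsFiniteMeasure ((μH[1] : Measure (Eu 2)).restrict (sphere 0 ρ)) := by
  have : IsFiniteMeasure
      (ENNReal.ofReal ρ • (volume.restrict (Set.Ioc (-π) π)).map (circleParam ρ)) :=
    Measure.smul_finite _ ENNReal.ofReal_ne_top
  exact isFiniteMeasure_of_le _ (hausdorffMeasure_restrict_sphere_le hρ)

/-- An arc of a circle has length at least its chord. -/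
lemma chord_le_hausdorffMeasure_arc {ρ a b : ℝ} (hab : a ≤ b) :
    ENNReal.ofReal (2 * ρ * Real.sin ((b - a) / 2)) ≤
      (μH[1] : Measure (Eu 2)) (circleParam ρ '' Set.Ioc a b) := by
  set m := (a + b) / 2 with hm
  set s := Real.sin ((b - a) / 2) with hs
  let P : ℂ → ℝ := fun z => (z * Complex.exp (-(m * Complex.I))).im
  let Q : Eu 2 → ℝ := fun x => P (Complex.orthonormalBasisOneI.repr.symm x)
  have hP : LipschitzWith 1 P := by
    refine LipschitzWith.of_dist_le_mul fun z w => ?_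
    have h1 : P z - P w = ((z - w) * Complex.exp (-(m * Complex.I))).im := by
      simp only [P, sub_mul, Complex.sub_im]
    have h2 : ‖Complex.exp (-(m * Complex.I))‖ = 1 := by
      have := Complex.norm_exp_ofReal_mul_I (-m)
      simpa using this
    rw [Real.dist_eq, h1, NNReal.coe_one, one_mul, dist_eq_norm]
    refine (Complex.abs_im_le_norm _).trans ?_
    rw [norm_mul, h2, mul_one]
  have hQ : LipschitzWith 1 Q := by
    have := hP.comp Complex.orthonormalBasisOneI.repr.symm.isometry.lipschitz
    rwa [one_mul] at this
  have hQγ : ∀ θ, Q (circleParam ρ θ) = ρ * Real.sin (θ - m) := by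
    intro θ
    simp only [Q, P, circleParam, LinearIsometryEquiv.symm_apply_apply, circleMap_zero]
    rw [mul_assoc, ← Complex.exp_add]
    have : (θ : ℂ) * Complex.I + -(m * Complex.I) = ((θ - m : ℝ) : ℂ) * Complex.I := by
      push_cast; ring
    rw [this, Complex.im_ofReal_mul, Complex.exp_ofReal_mul_I_im]
  have hsub : Set.Ioo (-(ρ * s)) (ρ * s) ⊆ Q '' (circleParam ρ '' Set.Ioc a b) := by
    intro y hy
    have hc : Set.Icc (ρ * Real.sin (a - m)) (ρ * Real.sin (b - m)) ⊆
        (fun θ => ρ * Real.sin (θ - m)) '' Set.Icc a b :=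
      intermediate_value_Icc (f := fun θ => ρ * Real.sin (θ - m)) hab
        (Continuous.continuousOn (by fun_prop))
    have e1 : a - m = -((b - a) / 2) := by rw [hm]; ring
    have e2 : b - m = (b - a) / 2 := by rw [hm]; ring
    have e3 : ρ * Real.sin (a - m) = -(ρ * s) := by rw [e1, Real.sin_neg]; ring
    rw [e3, e2, ← hs] at hc
    obtain ⟨θ, hθ, hθy⟩ := hc ⟨hy.1.le, hy.2.le⟩
    refine ⟨circleParam ρ θ, ⟨θ, ⟨lt_of_le_of_ne hθ.1 ?_, hθ.2⟩, rfl⟩, (hQγ θ).trans hθy⟩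
    rintro rfl
    have : y = -(ρ * s) := hθy.symm.trans e3
    exact absurd hy.1 (by rw [this]; exact lt_irrefl _)
  have h1 := hQ.hausdorffMeasure_image_le zero_le_one (circleParam ρ '' Set.Ioc a b)
  rw [hausdorffMeasure_real, ENNReal.coe_one, ENNReal.one_rpow, one_mul] at h1
  refine le_trans ?_ ((measure_mono hsub).trans h1)
  rw [Real.volume_Ioo]
  exact ENNReal.ofReal_le_ofReal (by linarith)

lemma two_pi_mul_le_hausdorffMeasure_sphere {ρ : ℝ} (hρ : 0 < ρ) :
    ENNReal.ofReal (2 * π * ρ) ≤ (μH[1] : Measure (Eu 2)) (sphere 0 ρ) := by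
  let A : Eu 2 → ℝ := fun x => (Complex.orthonormalBasisOneI.repr.symm x).arg
  have hA : Measurable A :=
    Complex.measurable_arg.comp Complex.orthonormalBasisOneI.repr.symm.continuous.measurable
  set ν : Measure ℝ := ((μH[1] : Measure (Eu 2)).restrict (sphere 0 ρ)).map A with hν
  have harc : ∀ a b : ℝ, -π ≤ a → b ≤ π → a ≤ b →
      ENNReal.ofReal (2 * ρ * Real.sin ((b - a) / 2)) ≤ ν (Set.Ioc a b) := by
    intro a b ha hb hab
    refine (chord_le_hausdorffMeasure_arc hab).trans ?_
    rw [hν, Measure.map_apply hA measurableSet_Ioc,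
      Measure.restrict_apply (hA measurableSet_Ioc)]
    refine measure_mono ?_
    rintro _ ⟨θ, hθ, rfl⟩
    have hz : A (circleParam ρ θ) = θ := by
      simp only [A, circleParam, LinearIsometryEquiv.symm_apply_apply, circleMap_zero]
      rw [Complex.exp_mul_I]
      exact Complex.arg_mul_cos_add_sin_mul_I hρ ⟨ha.trans_lt hθ.1, hθ.2.trans hb⟩
    refine ⟨by rwa [Set.mem_preimage, hz], ?_⟩
    simp [circleParam, abs_of_pos hρ]
  have hsum : ∀ n : ℕ, 0 < n → ∀ k : ℕ, k ≤ n →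
      ENNReal.ofReal (k * (2 * ρ * Real.sin (π / n))) ≤
        ν (Set.Ioc (-π) (-π + k * (2 * π / n))) := by
    intro n hn k
    have hn' : (1 : ℝ) ≤ n := by exact_mod_cast hn
    have hh : 0 < 2 * π / n := by positivity
    have hs : 0 ≤ Real.sin (π / n) :=
      Real.sin_nonneg_of_nonneg_of_le_pi (by positivity) (div_le_self pi_pos.le hn')
    induction k with
    | zero => simp
    | succ k ih =>
      intro hk
      have hk' : ((k + 1 : ℕ) : ℝ) ≤ n := by exact_mod_cast hk
      have h1 := ih (by omega)
      have hle : -π + (k + 1 : ℕ) * (2 * π / n) ≤ π := by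
        have := mul_le_mul_of_nonneg_right hk' hh.le
        have h3 : (n : ℝ) * (2 * π / n) = 2 * π := by field_simp
        linarith
      have hmid : -π ≤ -π + k * (2 * π / n) := by
        have : 0 ≤ k * (2 * π / n) := by positivity
        linarith
      have hstep : -π + k * (2 * π / n) ≤ -π + (k + 1 : ℕ) * (2 * π / n) := by
        push_cast; linarith
      have h2 := harc _ _ hmid hle hstep
      have he : (-π + (k + 1 : ℕ) * (2 * π / n) - (-π + k * (2 * π / n))) / 2 = π / n := by
        push_cast; ring
      rw [he] at h2
      rw [← Set.Ioc_union_Ioc_eq_Ioc hmid hstep, measure_union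
        (Set.Ioc_disjoint_Ioc_of_le le_rfl) measurableSet_Ioc]
      refine le_trans (le_of_eq ?_) (add_le_add h1 h2)
      rw [← ENNReal.ofReal_add (by positivity) (by positivity)]
      congr 1
      push_cast; ring
  have htop : ν Set.univ = (μH[1] : Measure (Eu 2)) (sphere 0 ρ) := by
    rw [hν, Measure.map_apply hA MeasurableSet.univ]
    simp
  rw [← htop]
  have hbound : ∀ n : ℕ, 0 < n →
      ENNReal.ofReal (2 * π * ρ - (ρ * π ^ 3 / 3) * (1 / (n : ℝ)) ^ 2) ≤ ν Set.univ := by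
    intro n hn
    have hn' : (0 : ℝ) < n := by exact_mod_cast hn
    refine le_trans (ENNReal.ofReal_le_ofReal ?_)
      ((hsum n hn n le_rfl).trans (measure_mono (Set.subset_univ _)))
    have h1 := (Real.sin_gt_sub_cube (x := π / n) (by positivity)).le
    have h2 := mul_le_mul_of_nonneg_left h1 (by positivity : 0 ≤ (n : ℝ) * (2 * ρ))
    refine le_trans (le_of_eq ?_) (h2.trans (le_of_eq (by ring)))
    field_simp
    ring
  refine le_of_tendsto (f := fun n : ℕ =>
    ENNReal.ofReal (2 * π * ρ - (ρ * π ^ 3 / 3) * (1 / (n : ℝ)) ^ 2)) ?_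
    (eventually_atTop.2 ⟨1, fun n hn => hbound n hn⟩)
  refine ENNReal.tendsto_ofReal ?_
  have h := ((tendsto_one_div_atTop_nhds_zero_nat (𝕜 := ℝ)).pow 2).const_mul (ρ * π ^ 3 / 3)
  simpa using h.const_sub (2 * π * ρ)

lemma measurable_polar_integrand {h : Eu 2 → ENNReal} (hh : Measurable h) :
    Measurable fun p : ℝ × ℝ => ENNReal.ofReal p.1 * h (circleParam p.1 p.2) := by
  have hcont : Continuous fun p : ℝ × ℝ => circleParam p.1 p.2 := by
    unfold circleParam circleMap
    fun_prop
  exact (ENNReal.measurable_ofReal.comp measurable_fst).mul (hh.comp hcont.measurable)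

lemma lintegral_eq_polar {h : Eu 2 → ENNReal} (hh : Measurable h) :
    ∫⁻ x, h x = ∫⁻ θ in Set.Ioo (-π) π, ∫⁻ r in Set.Ioi (0 : ℝ),
      ENNReal.ofReal r * h (circleParam r θ) := by
  have hmp : MeasurePreserving Complex.orthonormalBasisOneI.repr :=
    Complex.orthonormalBasisOneI.repr.measurePreserving
  have hpol : ∀ p : ℝ × ℝ, Complex.orthonormalBasisOneI.repr (Complex.polarCoord.symm p) =
      circleParam p.1 p.2 := by
    intro p
    rw [circleParam, circleMap_zero, Complex.polarCoord_symm_apply, Complex.exp_mul_I]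
    simp
  have hm := measurable_polar_integrand hh
  rw [← hmp.lintegral_comp hh, ← Complex.lintegral_comp_polarCoord_symm]
  simp only [hpol, smul_eq_mul]
  rw [polarCoord_target, Measure.volume_eq_prod, ← Measure.prod_restrict,
    lintegral_prod_symm _ hm.aemeasurable]

/-- One-dimensional trace estimate for Lipschitz functions with the weight `r dr`. -/
lemma enorm_sq_mul_sq_le_lintegral {ρ : ℝ} (hρ : 0 < ρ) {f G : ℝ → ℝ} {K : NNReal}
    (hf : LipschitzWith K f)
    (hG : ∀ᵐ r ∂volume.restrict (Set.Ioi (0 : ℝ)), r < ρ → |deriv f r| ≤ G r) :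
    ENNReal.ofReal (ρ ^ 2 * f ρ ^ 2) ≤ ∫⁻ r in Set.Ioo 0 ρ,
      ENNReal.ofReal r * ENNReal.ofReal (2 * f r ^ 2 + 2 * ρ * (|f r| * G r)) := by
  have hac : AbsolutelyContinuousOnInterval f 0 ρ :=
    (hf.lipschitzOnWith).absolutelyContinuousOnInterval
  have hid : AbsolutelyContinuousOnInterval (fun r : ℝ => r) 0 ρ :=
    (LipschitzWith.id.lipschitzOnWith).absolutelyContinuousOnInterval
  have hF := (hid.mul hac).mul (hid.mul hac)
  have hint := hF.integral_deriv_eq_sub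
  rw [intervalIntegral.integral_of_le hρ.le, integral_Ioc_eq_integral_Ioo] at hint
  have h1 : ρ ^ 2 * f ρ ^ 2 =
      ∫ r in Set.Ioo 0 ρ, deriv (((fun r : ℝ => r) * f) * ((fun r : ℝ => r) * f)) r := by
    rw [hint]
    simp only [Pi.mul_apply]
    ring
  rw [h1]
  refine (ENNReal.ofReal_le_ofReal (le_abs_self _)).trans ?_
  rw [← Real.enorm_eq_ofReal_abs]
  refine (enorm_integral_le_lintegral_enorm _).trans ?_
  refine lintegral_mono_ae ?_
  have hG' := ae_restrict_of_ae_restrict_of_subset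
    (fun x (hx : x ∈ Set.Ioo 0 ρ) => Set.mem_Ioi.2 hx.1) hG
  filter_upwards [hG', ae_restrict_of_ae hf.ae_differentiableAt,
    ae_restrict_mem measurableSet_Ioo] with r hr hd hmem
  have hr0 : 0 < r := hmem.1
  have hder := (((hasDerivAt_id r).mul hd.hasDerivAt).mul ((hasDerivAt_id r).mul hd.hasDerivAt))
  have hderiv : deriv (((fun r : ℝ => r) * f) * ((fun r : ℝ => r) * f)) r =
      r * (2 * f r ^ 2 + 2 * r * (f r * deriv f r)) := by
    refine (HasDerivAt.deriv hder).trans ?_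
    simp
    ring
  rw [hderiv, Real.enorm_eq_ofReal_abs, abs_mul, abs_of_pos hr0,
    ENNReal.ofReal_mul hr0.le]
  gcongr
  refine (abs_add_le _ _).trans ?_
  rw [abs_of_nonneg (by positivity : 0 ≤ 2 * f r ^ 2), abs_mul, abs_mul (f r),
    abs_of_pos (by positivity : 0 < 2 * r)]
  have h2 := hr hmem.2
  have h3 : |f r| * |deriv f r| ≤ |f r| * G r := mul_le_mul_of_nonneg_left h2 (abs_nonneg _)
  have h4 : 0 ≤ |f r| * |deriv f r| := by positivity
  have h5 : 2 * r * (|f r| * |deriv f r|) ≤ 2 * ρ * (|f r| * G r) :=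
    mul_le_mul (by linarith [hmem.2]) h3 h4 (by positivity)
  linarith

lemma lintegral_sphere_le {ρ : ℝ} (hρ : 0 < ρ) {u : Eu 2 → ℝ} {K : NNReal}
    (hu : LipschitzWith K u) :
    ENNReal.ofReal ρ * ∫⁻ x in sphere (0 : Eu 2) ρ, ENNReal.ofReal (u x ^ 2) ∂μH[1] ≤
      ∫⁻ x in ball (0 : Eu 2) ρ,
        ENNReal.ofReal (2 * u x ^ 2 + 2 * ρ * (|u x| * ‖fderiv ℝ u x‖)) := by
  have huc := hu.continuous
  have hγm : Measurable (circleParam ρ) := lipschitzWith_circleParam.continuous.measurable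
  have hradial : ∀ r θ : ℝ, circleParam r θ = r • circleParam 1 θ := by
    intro r θ
    simp only [circleParam, circleMap_zero, ← map_smul]
    simp
  have hnorm : ∀ θ : ℝ, ‖circleParam 1 θ‖ = 1 := by
    intro θ
    simp [circleParam]
  set H : Eu 2 → ENNReal := fun x =>
    ENNReal.ofReal (2 * u x ^ 2 + 2 * ρ * (|u x| * ‖fderiv ℝ u x‖)) with hH
  have hHm : Measurable H := by
    have := (measurable_fderiv ℝ u).norm
    have := huc.measurable
    fun_prop
  have hN : MeasurableSet {x : Eu 2 | DifferentiableAt ℝ u x} :=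
    measurableSet_of_differentiableAt ℝ u
  have hdiff : ∀ᵐ θ ∂volume.restrict (Set.Ioo (-π) π), ∀ᵐ r ∂volume.restrict (Set.Ioi (0 : ℝ)),
      DifferentiableAt ℝ u (circleParam r θ) := by
    have h1m : Measurable ({x : Eu 2 | DifferentiableAt ℝ u x}ᶜ.indicator (1 : Eu 2 → ENNReal)) :=
      measurable_one.indicator hN.compl
    have h0 : ∫⁻ x, {x : Eu 2 | DifferentiableAt ℝ u x}ᶜ.indicator (1 : Eu 2 → ENNReal) x = 0 := by
      rw [lintegral_indicator_one hN.compl]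
      exact hu.ae_differentiableAt
    have hm := measurable_polar_integrand h1m
    rw [lintegral_eq_polar h1m] at h0
    have hin := (hm.comp measurable_swap).lintegral_prod_right'
      (ν := volume.restrict (Set.Ioi (0 : ℝ)))
    filter_upwards [(lintegral_eq_zero_iff hin).1 h0] with θ hθ
    have hθ' := (lintegral_eq_zero_iff (hm.comp (measurable_id.prodMk measurable_const))).1 hθ
    filter_upwards [hθ', ae_restrict_mem measurableSet_Ioi] with r hr hr0
    by_contra hcon
    have hr1 : ENNReal.ofReal r *
        {x : Eu 2 | DifferentiableAt ℝ u x}ᶜ.indicator 1 (circleParam r θ) = 0 := hr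
    rw [Set.indicator_of_mem (by exact hcon)] at hr1
    simp at hr1
    exact absurd hr1 (not_le.2 hr0)
  have hstep : ∀ᵐ θ ∂volume.restrict (Set.Ioo (-π) π),
      ENNReal.ofReal (ρ ^ 2 * u (circleParam ρ θ) ^ 2) ≤
        ∫⁻ r in Set.Ioo 0 ρ, ENNReal.ofReal r * H (circleParam r θ) := by
    filter_upwards [hdiff] with θ hθ
    have hline : LipschitzWith 1 fun r : ℝ => circleParam r θ := by
      refine LipschitzWith.of_dist_le_mul fun r s => ?_
      rw [hradial r, hradial s, dist_eq_norm, ← sub_smul, norm_smul, hnorm]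
      simp [Real.dist_eq]
    refine enorm_sq_mul_sq_le_lintegral hρ (f := fun r => u (circleParam r θ))
      (G := fun r => ‖fderiv ℝ u (circleParam r θ)‖) (hu.comp hline) ?_
    filter_upwards [hθ] with r hr _
    have hd : HasDerivAt (fun r : ℝ => circleParam r θ) (circleParam 1 θ) r := by
      have he : (fun r : ℝ => circleParam r θ) = fun r => r • circleParam 1 θ :=
        funext fun r => hradial r θ
      rw [he]
      simpa using (hasDerivAt_id r).smul_const (circleParam 1 θ)
    have := (hr.hasFDerivAt.comp_hasDerivAt r hd).deriv
    have h2 : deriv (fun r => u (circleParam r θ)) r =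
      fderiv ℝ u (circleParam r θ) (circleParam 1 θ) := this
    rw [h2, ← Real.norm_eq_abs]
    refine (ContinuousLinearMap.le_opNorm _ _).trans ?_
    rw [hnorm, mul_one]
  calc ENNReal.ofReal ρ * ∫⁻ x in sphere (0 : Eu 2) ρ, ENNReal.ofReal (u x ^ 2) ∂μH[1]
      ≤ ENNReal.ofReal ρ * (ENNReal.ofReal ρ * ∫⁻ θ in Set.Ioc (-π) π,
          ENNReal.ofReal (u (circleParam ρ θ) ^ 2)) := by
        gcongr
        refine (lintegral_mono' (hausdorffMeasure_restrict_sphere_le hρ) le_rfl).trans ?_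
        rw [lintegral_smul_measure, lintegral_map (by fun_prop) hγm, smul_eq_mul]
    _ = ∫⁻ θ in Set.Ioo (-π) π, ENNReal.ofReal (ρ ^ 2 * u (circleParam ρ θ) ^ 2) := by
        rw [← mul_assoc, ← ENNReal.ofReal_mul hρ.le, restrict_Ioo_eq_restrict_Ioc,
          ← lintegral_const_mul _ (by fun_prop)]
        simp only [← ENNReal.ofReal_mul (mul_nonneg hρ.le hρ.le), sq]
    _ ≤ ∫⁻ θ in Set.Ioo (-π) π, ∫⁻ r in Set.Ioo 0 ρ, ENNReal.ofReal r * H (circleParam r θ) :=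
        lintegral_mono_ae hstep
    _ = ∫⁻ x in ball (0 : Eu 2) ρ, H x := by
        rw [← lintegral_indicator measurableSet_ball,
          lintegral_eq_polar (hHm.indicator measurableSet_ball)]
        congr 1
        ext θ
        rw [← Set.Ioi_inter_Iio, Set.inter_comm, ← Measure.restrict_restrict measurableSet_Iio,
          ← lintegral_indicator measurableSet_Iio]
        refine setLIntegral_congr_fun measurableSet_Ioi fun r hr => ?_
        have hr0 : (0 : ℝ) < r := hr
        have hmem : circleParam r θ ∈ ball (0 : Eu 2) ρ ↔ r ∈ Set.Iio ρ := by
          rw [hradial]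
          simp [norm_smul, hnorm, abs_of_pos hr0]
        by_cases h : r ∈ Set.Iio ρ
        · rw [Set.indicator_of_mem h, Set.indicator_of_mem (hmem.2 h)]
        · rw [Set.indicator_of_notMem h, Set.indicator_of_notMem (mt hmem.1 h), mul_zero]

lemma bddBelow_robinRayleighSet_ball {a ρ : ℝ} (ha : 0 < a) (hρ : 0 < ρ) :
    BddBelow (robinRayleighSet 2 (-a) (ball 0 ρ)) := by
  refine ⟨-(2 * a / ρ + a ^ 2), ?_⟩
  rintro _ ⟨u₀, K, hu₀, hne, rfl⟩
  rw [closure_ball _ hρ.ne'] at hu₀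
  obtain ⟨u, hu, huu⟩ := hu₀.extend_real
  have hball : ∀ x ∈ ball (0 : Eu 2) ρ, u₀ x = u x := fun x hx => huu (ball_subset_closedBall hx)
  have hD : (∫ x in ball (0 : Eu 2) ρ, u₀ x ^ 2) = ∫ x in ball (0 : Eu 2) ρ, u x ^ 2 :=
    setIntegral_congr_fun measurableSet_ball fun x hx => by simp only [hball x hx]
  have hN : (∫ x in ball (0 : Eu 2) ρ, ‖fderiv ℝ u₀ x‖ ^ 2) =
      ∫ x in ball (0 : Eu 2) ρ, ‖fderiv ℝ u x‖ ^ 2 := by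
    refine setIntegral_congr_fun measurableSet_ball fun x hx => ?_
    have : u₀ =ᶠ[nhds x] u := by
      filter_upwards [isOpen_ball.mem_nhds hx] with y hy using hball y hy
    have hfe := this.fderiv_eq (𝕜 := ℝ)
    simp only [hfe]
  have hT : (∫ x in frontier (ball (0 : Eu 2) ρ), u₀ x ^ 2 ∂(μH[((2 : ℕ) : ℝ) - 1])) =
      ∫ x in sphere (0 : Eu 2) ρ, u x ^ 2 ∂μH[1] := by
    have h1 : ((2 : ℕ) : ℝ) - 1 = 1 := by norm_num
    rw [h1, frontier_ball _ hρ.ne']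
    exact setIntegral_congr_fun isClosed_sphere.measurableSet fun x hx => by
      simp only [huu (sphere_subset_closedBall hx)]
  have huc := hu.continuous
  have hfd := (measurable_fderiv ℝ u).norm
  have hfb : ∀ x, ‖fderiv ℝ u x‖ ≤ K := fun x => norm_fderiv_le_of_lipschitz ℝ hu
  have hDi : IntegrableOn (fun x => u x ^ 2) (ball (0 : Eu 2) ρ) :=
    ((huc.pow 2).continuousOn.integrableOn_compact (isCompact_closedBall 0 ρ)).mono_set
      ball_subset_closedBall
  have hNi : IntegrableOn (fun x => ‖fderiv ℝ u x‖ ^ 2) (ball (0 : Eu 2) ρ) := by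
    refine IntegrableOn.of_bound measure_ball_lt_top (hfd.pow_const 2).aestronglyMeasurable
      ((K : ℝ) ^ 2) (ae_of_all _ fun x => ?_)
    rw [Real.norm_of_nonneg (by positivity)]
    exact pow_le_pow_left₀ (norm_nonneg _) (hfb x) 2
  have htrace : ρ * (∫ x in sphere (0 : Eu 2) ρ, u x ^ 2 ∂μH[1]) ≤
      ∫ x in ball (0 : Eu 2) ρ,
        (2 * u x ^ 2 + ρ * (a * u x ^ 2 + (1 / a) * ‖fderiv ℝ u x‖ ^ 2)) := by
    have hnn : ∀ x : Eu 2, 0 ≤ 2 * u x ^ 2 + ρ * (a * u x ^ 2 + (1 / a) * ‖fderiv ℝ u x‖ ^ 2) :=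
      fun x => by positivity
    have hi : IntegrableOn (fun x => 2 * u x ^ 2 +
        ρ * (a * u x ^ 2 + (1 / a) * ‖fderiv ℝ u x‖ ^ 2)) (ball (0 : Eu 2) ρ) :=
      (hDi.const_mul 2).add (((hDi.const_mul a).add (hNi.const_mul (1 / a))).const_mul ρ)
    rw [← ENNReal.ofReal_le_ofReal_iff (integral_nonneg hnn), ENNReal.ofReal_mul hρ.le,
      ofReal_integral_eq_lintegral_ofReal hi (ae_of_all _ hnn)]
    have hfin := isFiniteMeasure_hausdorffMeasure_restrict_sphere hρ
    have hTi : IntegrableOn (fun x => u x ^ 2) (sphere (0 : Eu 2) ρ) μH[1] := by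
      obtain ⟨C, hC⟩ := (isCompact_sphere (0 : Eu 2) ρ).exists_bound_of_continuousOn
        (huc.pow 2).continuousOn
      exact Integrable.of_bound (huc.pow 2).aestronglyMeasurable C
        ((ae_restrict_iff' isClosed_sphere.measurableSet).2 (ae_of_all _ hC))
    rw [ofReal_integral_eq_lintegral_ofReal hTi (ae_of_all _ fun x => sq_nonneg _)]
    refine (lintegral_sphere_le hρ hu).trans (lintegral_mono fun x => ENNReal.ofReal_le_ofReal ?_)
    have h1 : 2 * (|u x| * ‖fderiv ℝ u x‖) ≤ a * u x ^ 2 + 1 / a * ‖fderiv ℝ u x‖ ^ 2 := by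
      have h2 : 0 ≤ (1 / a) * (a * |u x| - ‖fderiv ℝ u x‖) ^ 2 := by positivity
      have h3 : (1 / a) * (a * |u x| - ‖fderiv ℝ u x‖) ^ 2 = a * |u x| ^ 2 +
          1 / a * ‖fderiv ℝ u x‖ ^ 2 - 2 * (|u x| * ‖fderiv ℝ u x‖) := by
        field_simp
        ring
      rw [sq_abs] at h3
      linarith
    have := mul_le_mul_of_nonneg_left h1 hρ.le
    linarith
  have hsplit : (∫ x in ball (0 : Eu 2) ρ,
      (2 * u x ^ 2 + ρ * (a * u x ^ 2 + (1 / a) * ‖fderiv ℝ u x‖ ^ 2))) =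
      (2 + ρ * a) * (∫ x in ball (0 : Eu 2) ρ, u x ^ 2) +
        ρ / a * ∫ x in ball (0 : Eu 2) ρ, ‖fderiv ℝ u x‖ ^ 2 := by
    rw [← integral_const_mul, ← integral_const_mul, ← integral_add (hDi.const_mul _)
      (hNi.const_mul _)]
    congr 1
    ext x
    ring
  rw [hsplit] at htrace
  rw [hD] at hne
  rw [hN, hT, hD]
  have hpos : 0 < ∫ x in ball (0 : Eu 2) ρ, u x ^ 2 :=
    lt_of_le_of_ne (integral_nonneg fun x => sq_nonneg _) hne.symm
  rw [le_div_iff₀ hpos]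
  have h := mul_le_mul_of_nonneg_left htrace (by positivity : 0 ≤ a / ρ)
  have e1 : a / ρ * (ρ * ∫ x in sphere (0 : Eu 2) ρ, u x ^ 2 ∂μH[1]) =
      a * ∫ x in sphere (0 : Eu 2) ρ, u x ^ 2 ∂μH[1] := by
    field_simp
  have e2 : a / ρ * ((2 + ρ * a) * (∫ x in ball (0 : Eu 2) ρ, u x ^ 2) +
        ρ / a * ∫ x in ball (0 : Eu 2) ρ, ‖fderiv ℝ u x‖ ^ 2) =
      (2 * a / ρ + a ^ 2) * (∫ x in ball (0 : Eu 2) ρ, u x ^ 2) +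
        ∫ x in ball (0 : Eu 2) ρ, ‖fderiv ℝ u x‖ ^ 2 := by
    field_simp
  rw [e1, e2] at h
  linarith

theorem disk_below_annulus_for_large_negative_alpha
    (r₁ r₂ : ℝ) (hr₁ : 0 < r₁) (hr₁₂ : r₁ < r₂) :
    ∃ α₁ : ℝ, α₁ < 0 ∧ ∀ α < α₁,
      robinEig 2 α (Metric.ball (0 : Eu 2) (Real.sqrt (r₂ ^ 2 - r₁ ^ 2))) < nrEig α r₁ r₂ := by
  have hr₂ : 0 < r₂ := hr₁.trans hr₁₂
  have hsub : 0 < r₂ ^ 2 - r₁ ^ 2 := by nlinarith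
  set ρ := Real.sqrt (r₂ ^ 2 - r₁ ^ 2) with hρdef
  have hρ : 0 < ρ := Real.sqrt_pos.2 hsub
  have hρr₂ : ρ < r₂ := by
    rw [hρdef, Real.sqrt_lt' hr₂]
    nlinarith
  have hinv : 1 / r₂ < 1 / ρ := one_div_lt_one_div_of_lt hρ hρr₂
  set M := (r₂ - r₁) / (r₁ * r₂) + 2 / (r₂ - r₁) with hM
  set ε := (1 / ρ - 1 / r₂) / 2 with hε
  have hε0 : 0 < ε := by rw [hε]; linarith
  have hq : 0 ≤ M ^ 2 / (4 * ε) := by positivity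
  refine ⟨-(M ^ 2 / (4 * ε)) - 1, by linarith, fun α hα => ?_⟩
  obtain ⟨a, rfl⟩ : ∃ a, α = -a := ⟨-α, (neg_neg α).symm⟩
  have ha : 0 < a := by linarith
  have hMa : M ^ 2 ≤ 4 * a * ε := by
    have h1 : M ^ 2 / (4 * ε) ≤ a := by linarith
    rw [div_le_iff₀ (by positivity)] at h1
    linarith
  refine (robinEig_ball_le ha hρ (isFiniteMeasure_hausdorffMeasure_restrict_sphere hρ)
    (two_pi_mul_le_hausdorffMeasure_sphere hρ) (bddBelow_robinRayleighSet_ball ha hρ)).trans_lt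
    (lt_of_lt_of_le ?_ (le_nrEig hr₁ hr₁₂ ha hMa))
  have h1 : 1 / r₂ + ε < 1 / ρ := by rw [hε]; linarith
  have h2 := mul_lt_mul_of_pos_left h1 ha
  have h3 : a / ρ = a * (1 / ρ) := by ring
  linarith

end
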